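/- Let σ > 0 be a real number and b ∈ ℕ. Set Δ = σ/2^b and Δ' = σ/2^{b+1}. Then (1 − e^{−Δ'}) · Σ_{i=0}^{2^{b+1} − 1} log₂(1 + i·Δ')·e^{−i·Δ'} − (1 − e^{−Δ}) · Σ_{i=0}^{2^b − 1} log₂(1 + i·Δ)·e^{−i·Δ} = ( e^{−Δ'} − e^{−Δ} ) · Σ_{j=0}^{2^b − 1} e^{−j·Δ} · log₂( 1 + (1/2) / ( 2^b/σ + j ) ). -/

import Mathlib

open scoped BigOperators

theorem sum_range_two_mul_aux (f : ℕ → ℝ) (n : ℕ) :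
    ∑ i ∈ Finset.range (2 * n), f i = ∑ j ∈ Finset.range n, (f (2 * j) + f (2 * j + 1)) := by
  induction n with
  | zero => simp
  | succ k ih =>
    rw [Nat.mul_succ, Finset.sum_range_succ, Finset.sum_range_succ, ih, Finset.sum_range_succ]
    ring

/-- Identity (10): the normalized one-extra-bit rate gain of the uniformly quantized
single-antenna link.  With `Δ = σ/2^b` and `Δ' = σ/2^{b+1}`,
`(1 − e^{−Δ'}) ∑_{i<2^{b+1}} log₂(1 + iΔ') e^{−iΔ'} − (1 − e^{−Δ}) ∑_{i<2^b} log₂(1 + iΔ) e^{−iΔ}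
 = (e^{−Δ'} − e^{−Δ}) ∑_{j<2^b} e^{−jΔ} log₂(1 + (1/2)/(2^b/σ + j))`. -/
theorem one_bit_rate_gain (σ : ℝ) (hσ : 0 < σ) (b : ℕ)
    (Δ Δ' : ℝ) (hΔ : Δ = σ / 2 ^ b) (hΔ' : Δ' = σ / 2 ^ (b + 1)) :
    (1 - Real.exp (-Δ')) *
        (∑ i ∈ Finset.range (2 ^ (b + 1)),
          Real.logb 2 (1 + (i : ℝ) * Δ') * Real.exp (-((i : ℝ) * Δ')))
      - (1 - Real.exp (-Δ)) *
        (∑ i ∈ Finset.range (2 ^ b),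
          Real.logb 2 (1 + (i : ℝ) * Δ) * Real.exp (-((i : ℝ) * Δ)))
      = (Real.exp (-Δ') - Real.exp (-Δ)) *
        ∑ j ∈ Finset.range (2 ^ b),
          Real.exp (-((j : ℝ) * Δ)) *
            Real.logb 2 (1 + (1 / 2) / ((2 : ℝ) ^ b / σ + (j : ℝ))) := by
  have hΔpos : 0 < Δ := by rw [hΔ]; positivity
  have hD : Δ = 2 * Δ' := by
    rw [hΔ, hΔ', pow_succ]; field_simp
  have hinv : (2 : ℝ) ^ b / σ = 1 / Δ := by rw [hΔ]; field_simp
  have hx : Real.exp (-Δ) = Real.exp (-Δ') * Real.exp (-Δ') := by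
    rw [← Real.exp_add, hD]; congr 1; ring
  rw [pow_succ, mul_comm (2 ^ b) 2, sum_range_two_mul_aux, hinv, hx, Finset.mul_sum,
    Finset.mul_sum, Finset.mul_sum, ← Finset.sum_sub_distrib]
  refine Finset.sum_congr rfl fun j _ => ?_
  have hj : (0 : ℝ) ≤ j := Nat.cast_nonneg j
  have hpos : 0 < 1 + (j : ℝ) * Δ := by positivity
  have hpos' : 0 < 1 + (j : ℝ) * Δ + Δ / 2 := by positivity
  have e1 : ((2 * j : ℕ) : ℝ) * Δ' = j * Δ := by push_cast; rw [hD]; ring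
  have e2 : ((2 * j + 1 : ℕ) : ℝ) * Δ' = j * Δ + Δ / 2 := by push_cast; rw [hD]; ring
  have e3 : Real.exp (-((j : ℝ) * Δ + Δ / 2)) = Real.exp (-((j : ℝ) * Δ)) * Real.exp (-Δ') := by
    rw [← Real.exp_add, hD]; congr 1; ring
  have e4 : 1 + (1 / 2) / (1 / Δ + (j : ℝ)) = (1 + (j : ℝ) * Δ + Δ / 2) / (1 + (j : ℝ) * Δ) := by
    have h : 1 / Δ + (j : ℝ) = (1 + (j : ℝ) * Δ) / Δ := by field_simp
    rw [h]; field_simp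
  rw [e1, e2, e3, e4, Real.logb_div hpos'.ne' hpos.ne', ← add_assoc]
  ring
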